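/- Fix n clients with inputs I = {r_1,…,r_n} and outputs O = {a_1,…,a_n}. For every k ≥ n there exists a controller (a deterministic supervisor) Cnt over (I, O), namely the round-robin arbiter, such that every word in L(Cnt) satisfies Mutex(n), NoLoss(n), NoSpurious(n), and Response(n, k); i.e., the invariance specification ArbCommit(n, k) augmented with NoLoss and NoSpurious is realizable whenever k ≥ n. -/

import Mathlib

/-- A letter of the alphabet `Σ = 2^I × 2^O`: a valuation of the input variables
together with a valuation of the output variables. -/
abbrev Letter (I O : Type) : Type := (I → Bool) × (O → Bool)

/-- An output-nondeterministic Mealy machine over input variables `I` and output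
variables `O`: a total deterministic finite automaton over `Σ = 2^I × 2^O` with a
distinguished reject state which is the unique non-final state and is a sink, and
whose initial state is final. -/
structure Mealy (I O Q : Type) where
  step : Q → Letter I O → Q
  start : Q
  reject : Q
  start_ne_reject : start ≠ reject
  reject_sink : ∀ a, step reject a = reject

namespace Mealy

variable {I O Q : Type}

/-- The extended transition function. -/
def evalFrom (M : Mealy I O Q) (q : Q) (w : List (Letter I O)) : Q :=
  w.foldl M.step q

/-- The language accepted by a Mealy machine: since the reject state is the unique
non-final state and is a sink, a word is accepted iff its run never reaches the
reject state. -/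
def lang (M : Mealy I O Q) : Set (List (Letter I O)) :=
  {w | M.evalFrom M.start w ≠ M.reject}

/-- A Mealy machine is non-blocking if from every final state and every input there
is an output leading to a final state.  A supervisor is a non-blocking
output-nondeterministic Mealy machine. -/
def NonBlocking (M : Mealy I O Q) : Prop :=
  ∀ q, q ≠ M.reject → ∀ i : I → Bool, ∃ o : O → Bool, M.step q (i, o) ≠ M.reject

/-- A Mealy machine is deterministic if from every final state and every input at
most one output avoids the reject state.  A controller is a deterministic
supervisor. -/
def Deterministic (M : Mealy I O Q) : Prop :=
  ∀ q, q ≠ M.reject → ∀ i : I → Bool, ∀ o₁ o₂ : O → Bool,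
    M.step q (i, o₁) ≠ M.reject → M.step q (i, o₂) ≠ M.reject → o₁ = o₂

end Mealy

/-- `Mutex(n)`: in every letter of the word at most one acknowledgement is true. -/
def Mutex (n : ℕ) (σ : List (Letter (Fin n) (Fin n))) : Prop :=
  ∀ l ∈ σ, ∀ i j : Fin n, l.2 i = true → l.2 j = true → i = j

/-- `NoLoss(n)`: in every letter, whenever some request is true, some acknowledgement
is true. -/
def NoLoss (n : ℕ) (σ : List (Letter (Fin n) (Fin n))) : Prop :=
  ∀ l ∈ σ, (∃ i : Fin n, l.1 i = true) → ∃ j : Fin n, l.2 j = true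

/-- `NoSpurious(n)`: in every letter, an acknowledgement is given only to a requesting
client. -/
def NoSpurious (n : ℕ) (σ : List (Letter (Fin n) (Fin n))) : Prop :=
  ∀ l ∈ σ, ∀ i : Fin n, l.2 i = true → l.1 i = true

/-- `Response(n, k)`: for every client `i` and every block of `k` consecutive positions
at all of which `r_i` is true, `a_i` is true at at least one of those positions. -/
def Response (n k : ℕ) (σ : List (Letter (Fin n) (Fin n))) : Prop :=
  ∀ i : Fin n, ∀ b : ℕ, b + k ≤ σ.length →
    (∀ j, b ≤ j → j < b + k → (σ.getD j default).1 i = true) →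
    ∃ j, b ≤ j ∧ j < b + k ∧ (σ.getD j default).2 i = true

/-- Cyclic distance from the pointer `p` to client `i`. -/
def rrDist {n : ℕ} (p i : Fin n) : ℕ :=
  if p.val ≤ i.val then i.val - p.val else i.val + n - p.val

/-- The cyclic successor of a client. -/
def rrNext {n : ℕ} (g : Fin n) : Fin n :=
  if h : g.val + 1 < n then ⟨g.val + 1, h⟩ else ⟨0, by have := g.2; omega⟩

theorem rrDist_inj {n : ℕ} {p i j : Fin n} (h : rrDist p i = rrDist p j) : i = j := by
  have h1 := p.2
  have h2 := i.2
  have h3 := j.2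
  unfold rrDist at h
  apply Fin.ext
  split_ifs at h <;> omega

theorem rrDist_lt {n : ℕ} (p i : Fin n) : rrDist p i < n := by
  have h1 := p.2
  have h2 := i.2
  unfold rrDist
  split_ifs <;> omega

theorem rrDist_next {n : ℕ} {p g i : Fin n} (h : rrDist p g < rrDist p i) :
    rrDist (rrNext g) i < rrDist p i := by
  have h1 := p.2
  have h2 := i.2
  have h3 := g.2
  unfold rrDist rrNext at *
  split_ifs at * <;> simp at * <;> omega

/-- `g` is the requesting client closest to the pointer and is the one acknowledged. -/
def RRGrant {n : ℕ} (p : Fin n) (l : Letter (Fin n) (Fin n)) (g : Fin n) : Prop :=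
  l.1 g = true ∧ (∀ j, l.1 j = true → rrDist p g ≤ rrDist p j) ∧ l.2 = fun j => decide (j = g)

/-- No request and no acknowledgement. -/
def RRIdle {n : ℕ} (l : Letter (Fin n) (Fin n)) : Prop :=
  (∀ j, l.1 j = false) ∧ l.2 = fun _ => false

open Classical in
/-- Transition function of the round-robin arbiter. -/
noncomputable def rrStep {n : ℕ} : Option (Fin n) → Letter (Fin n) (Fin n) → Option (Fin n)
  | none, _ => none
  | some p, l =>
    if h : ∃ g, RRGrant p l g then some (rrNext h.choose)
    else if RRIdle l then some p else none

theorem rrStep_cases {n : ℕ} (p : Fin n) (l : Letter (Fin n) (Fin n))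
    (h : rrStep (some p) l ≠ none) :
    (∃ g, RRGrant p l g ∧ rrStep (some p) l = some (rrNext g)) ∨
      (RRIdle l ∧ rrStep (some p) l = some p) := by
  by_cases h1 : ∃ g, RRGrant p l g
  · exact Or.inl ⟨h1.choose, h1.choose_spec, by simp only [rrStep, dif_pos h1]⟩
  · by_cases h2 : RRIdle l
    · exact Or.inr ⟨h2, by simp only [rrStep, dif_neg h1, if_pos h2]⟩
    · exact absurd (by simp only [rrStep, dif_neg h1, if_neg h2]) h

/-- The round-robin arbiter. -/
noncomputable def rrArb (n : ℕ) (hn : 1 ≤ n) : Mealy (Fin n) (Fin n) (Option (Fin n)) where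
  step := rrStep
  start := some ⟨0, hn⟩
  reject := none
  start_ne_reject := by simp
  reject_sink := fun _ => rfl

theorem foldl_rrStep_none {n : ℕ} (w : List (Letter (Fin n) (Fin n))) :
    w.foldl rrStep none = none := by
  induction w with
  | nil => rfl
  | cons l w ih => exact ih

/-- Decomposition of an accepting run at its first letter. -/
theorem rr_cons {n : ℕ} {p : Fin n} {l : Letter (Fin n) (Fin n)}
    {w : List (Letter (Fin n) (Fin n))} (h : (l :: w).foldl rrStep (some p) ≠ none) :
    ∃ q, w.foldl rrStep (some q) ≠ none ∧
      ((∃ g, RRGrant p l g ∧ q = rrNext g) ∨ (RRIdle l ∧ q = p)) := by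
  rw [List.foldl_cons] at h
  have h0 : rrStep (some p) l ≠ none := by
    intro h0
    rw [h0] at h
    exact h (foldl_rrStep_none w)
  rcases rrStep_cases p l h0 with ⟨g, hg, e⟩ | ⟨hi, e⟩
  · rw [e] at h
    exact ⟨_, h, Or.inl ⟨g, hg, rfl⟩⟩
  · rw [e] at h
    exact ⟨_, h, Or.inr ⟨hi, rfl⟩⟩

theorem rr_letter {n : ℕ} (w : List (Letter (Fin n) (Fin n))) :
    ∀ p : Fin n, w.foldl rrStep (some p) ≠ none →
      ∀ l ∈ w, (∃ p g, RRGrant p l g) ∨ RRIdle l := by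
  induction w with
  | nil => simp
  | cons a w ih =>
    intro p h l hl
    obtain ⟨q, hq, hc⟩ := rr_cons h
    rcases List.mem_cons.1 hl with rfl | hl
    · rcases hc with ⟨g, hg, _⟩ | ⟨hi, _⟩
      · exact Or.inl ⟨p, g, hg⟩
      · exact Or.inr hi
    · exact ih q hq l hl

theorem rr_resp0 {n : ℕ} (i : Fin n) (w : List (Letter (Fin n) (Fin n))) :
    ∀ (p : Fin n) (m : ℕ), w.foldl rrStep (some p) ≠ none → rrDist p i < m → m ≤ w.length →
      (∀ j, j < m → (w.getD j default).1 i = true) →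
      ∃ j, j < m ∧ (w.getD j default).2 i = true := by
  induction w with
  | nil => intro p m _ h1 h2; simp at h2; omega
  | cons a w ih =>
    intro p m h hd hm hr
    obtain ⟨q, hq, hc⟩ := rr_cons h
    have ha : a.1 i = true := by simpa using hr 0 (by omega)
    rcases hc with ⟨g, ⟨hg1, hg2, hg3⟩, rfl⟩ | ⟨hi, _⟩
    · by_cases e : i = g
      · exact ⟨0, by omega, by simp [hg3, e]⟩
      · have hlt : rrDist p g < rrDist p i :=
          lt_of_le_of_ne (hg2 i ha) (fun e' => e (rrDist_inj e').symm)
        have hlt2 := rrDist_next hlt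
        simp only [List.length_cons] at hm
        obtain ⟨j, hj, hj2⟩ := ih (rrNext g) (m - 1) hq (by omega) (by omega)
          (fun j hj => by simpa using hr (j + 1) (by omega))
        exact ⟨j + 1, by omega, by simpa using hj2⟩
    · rw [hi.1 i] at ha
      exact absurd ha (by simp)

theorem rr_resp {n k : ℕ} (hkn : n ≤ k) (w : List (Letter (Fin n) (Fin n))) :
    ∀ p : Fin n, w.foldl rrStep (some p) ≠ none → Response n k w := by
  induction w with
  | nil =>
    intro p h i b hb
    have := i.2
    simp at hb
    omega
  | cons a w ih =>
    intro p h i b hb hr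
    cases b with
    | zero =>
      obtain ⟨j, hj, hj2⟩ := rr_resp0 i (a :: w) p k h (lt_of_lt_of_le (rrDist_lt p i) hkn)
        (by omega) (fun j hj => hr j (by omega) (by omega))
      exact ⟨j, by omega, by omega, hj2⟩
    | succ b =>
      obtain ⟨q, hq, _⟩ := rr_cons h
      simp only [List.length_cons] at hb
      obtain ⟨j, h1, h2, h3⟩ := ih q hq i b (by omega)
        (fun j h1 h2 => by simpa using hr (j + 1) (by omega) (by omega))
      exact ⟨j + 1, by omega, by omega, by simpa using h3⟩

/-- for every `k ≥ n ≥ 1` there is a controller (a deterministic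
supervisor, namely the round-robin arbiter) all of whose accepted words satisfy
`Mutex(n)`, `NoLoss(n)`, `NoSpurious(n)` and `Response(n, k)`: the invariance
specification `ArbCommit(n, k)` with `NoLoss` and `NoSpurious` is realizable whenever
`k ≥ n`. -/
theorem arbiter_realizable (n k : ℕ) (hn : 1 ≤ n) (hkn : n ≤ k) :
    ∃ (Q : Type) (_ : Fintype Q) (Cnt : Mealy (Fin n) (Fin n) Q),
      Cnt.NonBlocking ∧ Cnt.Deterministic ∧
      ∀ w ∈ Cnt.lang, Mutex n w ∧ NoLoss n w ∧ NoSpurious n w ∧ Response n k w := by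
  refine ⟨Option (Fin n), inferInstance, rrArb n hn, ?_, ?_, ?_⟩
  · intro q hq r
    obtain ⟨p, rfl⟩ := Option.ne_none_iff_exists'.1 hq
    by_cases hr : ∃ i, r i = true
    · obtain ⟨g, hg, hmin⟩ := Set.exists_min_image {i | r i = true} (rrDist p)
        (Set.toFinite _) hr
      refine ⟨fun j => decide (j = g), ?_⟩
      have h : ∃ g', RRGrant p (r, fun j => decide (j = g)) g' := ⟨g, hg, hmin, rfl⟩
      change rrStep (some p) _ ≠ none
      simp only [rrStep, dif_pos h]
      simp
    · refine ⟨fun _ => false, ?_⟩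
      have h : ¬ ∃ g', RRGrant p (r, fun _ => false) g' := fun ⟨g, hg⟩ => hr ⟨g, hg.1⟩
      have h2 : RRIdle (r, fun _ : Fin n => false) := ⟨by simpa using hr, rfl⟩
      change rrStep (some p) _ ≠ none
      simp only [rrStep, dif_neg h, if_pos h2]
      simp
  · intro q hq r o₁ o₂ h₁ h₂
    obtain ⟨p, rfl⟩ := Option.ne_none_iff_exists'.1 hq
    rcases rrStep_cases p _ h₁ with ⟨g, ⟨a1, a2, a3⟩, _⟩ | ⟨⟨a1, a2⟩, _⟩ <;>
    rcases rrStep_cases p _ h₂ with ⟨g', ⟨b1, b2, b3⟩, _⟩ | ⟨⟨b1, b2⟩, _⟩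
    · have e : g = g' := rrDist_inj (le_antisymm (a2 g' b1) (b2 g a1))
      subst e
      exact a3.trans b3.symm
    · simp_all
    · simp_all
    · exact a2.trans b2.symm
  · intro w hw
    have hl := rr_letter w _ hw
    refine ⟨?_, ?_, ?_, rr_resp hkn w _ hw⟩
    · intro l hm i j hi hj
      rcases hl l hm with ⟨p, g, _, _, h⟩ | ⟨_, h⟩
      · simp [h] at hi hj
        rw [hi, hj]
      · simp [h] at hi
    · rintro l hm ⟨i, hi⟩
      rcases hl l hm with ⟨p, g, _, _, h⟩ | ⟨h, _⟩
      · exact ⟨g, by simp [h]⟩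
      · simp [h] at hi
    · intro l hm i hi
      rcases hl l hm with ⟨p, g, h1, _, h⟩ | ⟨_, h⟩
      · simp [h] at hi
        rw [hi, h1]
      · simp [h] at hi
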